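/- arXiv:math/9809068 — 4 statements merged into one kernel-verified Lean document; each statement's English description precedes it below -/
import Mathlib

section
/- A topological space (X,τ) is sg-compact if and only if it is a C₃-space, i.e., if and only if every hereditarily sg-closed subset of X is finite. -/
open Set TopologicalSpace

/-- A set is semi-open if it is contained in the closure of its interior. -/
def SemiOpen {X : Type*} [TopologicalSpace X] (A : Set X) : Prop :=
  A ⊆ closure (interior A)

/-- A set is semi-closed if the interior of its closure is contained in it. -/
def SemiClosed {X : Type*} [TopologicalSpace X] (A : Set X) : Prop :=
  interior (closure A) ⊆ A

/-- The semi-closure of a set: intersection of all semi-closed supersets. -/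
def sCl {X : Type*} [TopologicalSpace X] (A : Set X) : Set X :=
  ⋂₀ {B | SemiClosed B ∧ A ⊆ B}

/-- A set is sg-closed if its semi-closure is contained in every semi-open superset. -/
def SgClosed {X : Type*} [TopologicalSpace X] (A : Set X) : Prop :=
  ∀ U : Set X, SemiOpen U → A ⊆ U → sCl A ⊆ U

/-- A set is sg-open if its complement is sg-closed. -/
def SgOpen {X : Type*} [TopologicalSpace X] (A : Set X) : Prop :=
  SgClosed Aᶜ

/-- A set is hereditarily sg-closed if every subset of it is sg-closed. -/
def HSgClosed {X : Type*} [TopologicalSpace X] (A : Set X) : Prop :=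
  ∀ B ⊆ A, SgClosed B

/-- A space is sg-compact if every cover by sg-open sets has a finite subcover. -/
def SgCompact (X : Type*) [TopologicalSpace X] : Prop :=
  ∀ 𝒰 : Set (Set X), (∀ U ∈ 𝒰, SgOpen U) → ⋃₀ 𝒰 = univ →
    ∃ ℱ ⊆ 𝒰, ℱ.Finite ∧ ⋃₀ ℱ = univ

/-- A space is semi-compact if every cover by semi-open sets has a finite subcover. -/
def SemiCompact (X : Type*) [TopologicalSpace X] : Prop :=
  ∀ 𝒰 : Set (Set X), (∀ U ∈ 𝒰, SemiOpen U) → ⋃₀ 𝒰 = univ →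
    ∃ ℱ ⊆ 𝒰, ℱ.Finite ∧ ⋃₀ ℱ = univ

/-- A C₂-space: every nowhere dense subset is finite. -/
def C2Space (X : Type*) [TopologicalSpace X] : Prop :=
  ∀ A : Set X, interior (closure A) = ∅ → A.Finite

/-- A C₃-space: every hereditarily sg-closed subset is finite. -/
def C3Space (X : Type*) [TopologicalSpace X] : Prop :=
  ∀ A : Set X, HSgClosed A → A.Finite

/-- A set is regular open if it equals the interior of its closure. -/
def RegularOpen {X : Type*} [TopologicalSpace X] (A : Set X) : Prop :=
  A = interior (closure A)

/-- A set is δ-open if it is a union of regular open sets. -/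
def DeltaOpen {X : Type*} [TopologicalSpace X] (A : Set X) : Prop :=
  ∃ 𝒞 : Set (Set X), (∀ R ∈ 𝒞, RegularOpen R) ∧ A = ⋃₀ 𝒞

section

variable {X : Type*} [TopologicalSpace X]

lemma sCl_subset_union_interior_closure (A : Set X) : sCl A ⊆ A ∪ interior (closure A) := by
  refine sInter_subset_of_mem ⟨?_, subset_union_left⟩
  have h : closure (A ∪ interior (closure A)) ⊆ closure A :=
    closure_minimal (union_subset subset_closure interior_subset) isClosed_closure
  exact (interior_mono h).trans subset_union_right

lemma interior_closure_subset_sCl (A : Set X) : interior (closure A) ⊆ sCl A :=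
  subset_sInter fun _ hB => (interior_mono (closure_mono hB.2)).trans hB.1

lemma SemiOpen.semiClosed_compl {U : Set X} (hU : SemiOpen U) : SemiClosed Uᶜ := by
  rw [SemiClosed, closure_compl, interior_compl]
  exact compl_subset_compl.2 hU

lemma semiOpen_compl_singleton {x : X} (hx : interior (closure {x}) = ∅) :
    SemiOpen ({x}ᶜ : Set X) := by
  rw [SemiOpen, interior_compl, closure_compl, hx, compl_empty]
  exact subset_univ _

/-- A set is sg-closed as soon as it contains every nowhere dense point of the interior of its
closure. -/
lemma sgClosed_of_forall_mem {A : Set X}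
    (h : ∀ x ∈ interior (closure A), interior (closure {x}) = ∅ → x ∈ A) : SgClosed A := by
  intro U hU hAU x hx
  rcases sCl_subset_union_interior_closure A hx with hxA | hxA
  · exact hAU hxA
  by_contra hxU
  have hne : (interior (closure {x})).Nonempty :=
    nonempty_iff_ne_empty.2 fun h0 => hxU (hAU (h x hxA h0))
  have hsub : interior (closure {x}) ⊆ Uᶜ :=
    (interior_mono (closure_mono (singleton_subset_iff.2 hxU))).trans hU.semiClosed_compl
  have hx' : x ∈ interior (closure {x}) := by
    obtain ⟨y, hy⟩ := hne
    obtain ⟨z, hz, rfl⟩ := mem_closure_iff.1 (interior_subset hy) _ isOpen_interior hy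
    exact hz
  obtain ⟨y, hy, hyA⟩ := mem_closure_iff.1 (interior_subset hxA) _ isOpen_interior hx'
  exact hsub hy (hAU hyA)

/-- A nowhere dense point of an sg-open set lies in the closure of its interior. -/
lemma SgOpen.mem_closure_interior {U : Set X} (hU : SgOpen U) {x : X} (hxU : x ∈ U)
    (hx : interior (closure {x}) = ∅) : x ∈ closure (interior U) := by
  by_contra hxc
  have hxs : x ∈ sCl Uᶜ := by
    apply interior_closure_subset_sCl
    rwa [closure_compl, interior_compl]
  exact hU _ (semiOpen_compl_singleton hx)
    (compl_subset_compl.2 (singleton_subset_iff.2 hxU)) hxs rfl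

lemma hsgClosed_of_forall_nonempty {A : Set X}
    (h : ∀ x ∈ interior (closure A), interior (closure {x}) ≠ ∅) : HSgClosed A := fun _ hBA =>
  sgClosed_of_forall_mem fun x hx hx0 =>
    absurd hx0 (h x (interior_mono (closure_mono hBA) hx))

lemma SgCompact.finite_of_hsgClosed (hX : SgCompact X) {A : Set X} (hA : HSgClosed A) :
    A.Finite := by
  rcases A.eq_empty_or_nonempty with rfl | ⟨a, ha⟩
  · exact finite_empty
  obtain ⟨ℱ, hℱ, hfin, hcov⟩ := hX ((fun x => (A \ {x})ᶜ) '' A)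
    (by
      rintro _ ⟨x, -, rfl⟩
      rw [SgOpen, compl_compl]
      exact hA _ sdiff_subset)
    (by
      refine eq_univ_of_forall fun y => ?_
      by_cases hy : y ∈ A
      · exact ⟨_, ⟨y, hy, rfl⟩, fun h => h.2 rfl⟩
      · exact ⟨_, ⟨a, ha, rfl⟩, fun h => hy h.1⟩)
  refine Finite.of_finite_image (f := fun x => (A \ {x})ᶜ) (hfin.subset ?_) fun x hx y hy hxy => ?_
  · rintro _ ⟨y, hy, rfl⟩
    obtain ⟨F, hF, hyF⟩ := mem_sUnion.1 (hcov ▸ mem_univ y)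
    obtain ⟨x, hx, rfl⟩ := hℱ hF
    have hyx : y = x := by
      by_contra hne
      exact hyF ⟨hy, hne⟩
    rwa [hyx]
  · by_contra hne
    have hxm : x ∈ A \ {y} := ⟨hx, hne⟩
    rw [← compl_inj_iff.1 hxy] at hxm
    exact hxm.2 rfl

/-- In a C₃-space, a sequence of pairwise disjoint open sets has a member without nowhere dense
points. -/
lemma C3Space.exists_forall_nonempty (hX : C3Space X) {G : ℕ → Set X} (hG : ∀ n, IsOpen (G n))
    (hd : Pairwise (Function.onFun Disjoint G)) :
    ∃ n, ∀ x ∈ G n, interior (closure {x}) ≠ ∅ := by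
  by_contra! h
  choose z hzG hz using h
  have hinj : Function.Injective z := fun m n hmn => by
    by_contra hne
    exact disjoint_left.1 (hd hne) (hzG m) (hmn ▸ hzG n)
  have hnd : interior (closure (range z)) = ∅ := by
    by_contra hne
    obtain ⟨y, hy⟩ := nonempty_iff_ne_empty.2 hne
    obtain ⟨_, hw, n, rfl⟩ := mem_closure_iff.1 (interior_subset hy) _ isOpen_interior hy
    have hsub : G n ∩ interior (closure (range z)) ⊆ closure {z n} := by
      rintro w ⟨hwG, hwc⟩
      refine mem_closure_iff.2 fun O hO hwO => ?_
      obtain ⟨_, hv, m, rfl⟩ :=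
        mem_closure_iff.1 (interior_subset hwc) _ (hO.inter (hG n)) ⟨hwO, hwG⟩
      have hmn : m = n := by
        by_contra hne
        exact disjoint_left.1 (hd hne) (hzG m) hv.2
      subst hmn
      exact ⟨_, hv.1, rfl⟩
    have := interior_maximal hsub ((hG n).inter isOpen_interior) ⟨hzG n, hw⟩
    rw [hz n] at this
    exact this
  refine infinite_range_of_injective hinj (hX _ (hsgClosed_of_forall_nonempty fun x hx => ?_))
  rw [hnd] at hx
  exact hx.elim

/-- In a C₃-space, a sequence of pairwise disjoint open sets has an empty member. -/
lemma C3Space.exists_eq_empty (hX : C3Space X) {W : ℕ → Set X} (hW : ∀ n, IsOpen (W n))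
    (hd : Pairwise (Function.onFun Disjoint W)) : ∃ n, W n = ∅ := by
  by_contra! h
  choose x hx using h
  let Y : ℕ → Set X := fun k => ⋃ j, W (Nat.pair k j)
  have hY : ∀ k, IsOpen (Y k) := fun k => isOpen_iUnion fun j => hW _
  have hYd : Pairwise (Function.onFun Disjoint fun k => interior (closure (Y k))) := by
    intro k l hkl
    have hYkl : Disjoint (Y k) (Y l) := by
      simp only [Y, disjoint_iUnion_left, disjoint_iUnion_right]
      intro i j
      refine hd fun hp => hkl ?_
      exact (Nat.pair_eq_pair.1 hp).1
    exact ((hYkl.closure_left (hY l)).mono_left interior_subset).closure_right isOpen_interior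
      |>.mono_right interior_subset
  obtain ⟨k, hk⟩ := hX.exists_forall_nonempty (fun _ => isOpen_interior) hYd
  have hinj : Function.Injective fun j => x (Nat.pair k j) := fun i j hij => by
    by_contra hne
    have hp : Nat.pair k i ≠ Nat.pair k j := fun hp => hne (Nat.pair_eq_pair.1 hp).2
    refine disjoint_left.1 (hd hp) (hx _) ?_
    have := hx (Nat.pair k j)
    rwa [← show x (Nat.pair k i) = x (Nat.pair k j) from hij] at this
  refine infinite_range_of_injective hinj (hX _ (hsgClosed_of_forall_nonempty fun y hy => hk y ?_))
  refine interior_mono (closure_mono ?_) hy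
  rintro _ ⟨j, rfl⟩
  exact mem_iUnion.2 ⟨j, hx _⟩

/-- In a C₃-space, every family of sets has a finite subfamily the union of whose interiors is
dense in the union of all the interiors. -/
lemma C3Space.exists_finite_interior_subset_closure (hX : C3Space X) (𝒰 : Set (Set X)) :
    ∃ ℱ ⊆ 𝒰, ℱ.Finite ∧ ∀ U ∈ 𝒰, interior U ⊆ closure (⋃ V ∈ ℱ, interior V) := by
  by_contra! h
  obtain ⟨W, hW, hd⟩ := exists_seq_of_forall_finset_exists'
    (fun W : Set X => IsOpen W ∧ W.Nonempty ∧ ∃ U ∈ 𝒰, W ⊆ interior U) Disjoint (by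
      intro s hs
      choose! f hf𝒰 hfW using fun W hW => (hs W hW).2.2
      obtain ⟨U, hU, hne⟩ := h (f '' s) (image_subset_iff.2 hf𝒰) (s.finite_toSet.image f)
      refine ⟨interior U \ closure (⋃ V ∈ f '' s, interior V),
        ⟨isOpen_interior.sdiff isClosed_closure, sdiff_nonempty.2 hne, U, hU, sdiff_subset⟩, fun W hW => ?_⟩
      refine disjoint_left.2 fun x hxW hx => hx.2 (subset_closure ?_)
      exact mem_iUnion₂.2 ⟨f W, mem_image_of_mem f hW, hfW W hW hxW⟩)
  obtain ⟨n, hn⟩ := hX.exists_eq_empty (fun n => (hW n).1) hd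
  exact (hW n).2.1.ne_empty hn

lemma C3Space.sgCompact (hX : C3Space X) : SgCompact X := by
  intro 𝒰 h𝒰 hcov
  obtain ⟨ℱ, hℱ, hfin, hdense⟩ := hX.exists_finite_interior_subset_closure 𝒰
  have hA : (⋃ V ∈ ℱ, interior V)ᶜ.Finite := by
    refine hX _ (hsgClosed_of_forall_nonempty fun x hx hx0 => ?_)
    rw [closure_compl, interior_compl] at hx
    obtain ⟨U, hU, hxU⟩ := mem_sUnion.1 (hcov ▸ mem_univ x)
    have hxi := (h𝒰 U hU).mem_closure_interior hxU hx0
    rw [(isOpen_biUnion fun _ _ => isOpen_interior).interior_eq] at hx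
    exact hx (closure_minimal (hdense U hU) isClosed_closure hxi)
  have hmem : ∀ x, ∃ U ∈ 𝒰, x ∈ U := fun x => mem_sUnion.1 (hcov ▸ mem_univ x)
  choose u hu hxu using hmem
  refine ⟨ℱ ∪ u '' (⋃ V ∈ ℱ, interior V)ᶜ, union_subset hℱ (by rintro _ ⟨x, -, rfl⟩; exact hu x),
    hfin.union (hA.image u), eq_univ_of_forall fun x => ?_⟩
  by_cases hx : x ∈ ⋃ V ∈ ℱ, interior V
  · obtain ⟨V, hV, hxV⟩ := mem_iUnion₂.1 hx
    exact ⟨V, Or.inl hV, interior_subset hxV⟩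
  · exact ⟨u x, Or.inr ⟨x, hx, rfl⟩, hxu x⟩

end

/-- A space is sg-compact iff it is a C₃-space, i.e., iff
every hereditarily sg-closed subset is finite. -/
theorem stmt_4 {X : Type*} [TopologicalSpace X] :
    SgCompact X ↔ ∀ A : Set X, HSgClosed A → A.Finite := by
  exact ⟨fun h _ hA => h.finite_of_hsgClosed hA, fun h => C3Space.sgCompact h⟩
end

section
/- Let (X,τ) be a topological space. If A ⊆ X is sg-open and U ⊆ X is open, then A ∩ U is sg-open. -/
open Set TopologicalSpace

theorem sCl_eq_union_interior_closure {X : Type*} [TopologicalSpace X] (A : Set X) :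
    sCl A = A ∪ interior (closure A) := by
  refine Subset.antisymm (sInter_subset_of_mem ⟨?_, subset_union_left⟩) ?_
  · have h : closure (A ∪ interior (closure A)) ⊆ closure A :=
      closure_minimal (union_subset subset_closure interior_subset) isClosed_closure
    exact (interior_mono h).trans subset_union_right
  · rintro x hx B ⟨hB, hAB⟩
    rcases hx with hx | hx
    · exact hAB hx
    · exact hB (interior_mono (closure_mono hAB) hx)

theorem SgClosed.union_isClosed {X : Type*} [TopologicalSpace X] {B F : Set X}
    (hB : SgClosed B) (hF : IsClosed F) : SgClosed (B ∪ F) := by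
  intro V hV hBFV
  have hBV := hB V hV (subset_union_left.trans hBFV)
  rw [sCl_eq_union_interior_closure] at hBV ⊢
  refine union_subset hBFV fun x hx => ?_
  by_cases hxF : x ∈ F
  · exact hBFV (Or.inr hxF)
  · refine hBV (Or.inr (mem_interior.2
      ⟨interior (closure (B ∪ F)) ∩ Fᶜ, ?_, isOpen_interior.inter hF.isOpen_compl, hx, hxF⟩))
    rintro y ⟨hy, hyF⟩
    have hy' := interior_subset hy
    rw [closure_union, hF.closure_eq] at hy'
    exact hy'.resolve_right hyF

/-- The intersection of an sg-open set and an open set is sg-open. -/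
theorem stmt_6 {X : Type*} [TopologicalSpace X] {A U : Set X}
    (hA : SgOpen A) (hU : IsOpen U) : SgOpen (A ∩ U) := by
  rw [SgOpen, compl_inter]
  exact SgClosed.union_isClosed hA hU.isClosed_compl
end

section
/- Let (X,τ) be a topological space and let A ⊆ B ⊆ X, where B is δ-open in X and A is sg-open in the subspace (B, τ|B). Then A is sg-open in (X,τ). -/
open Set TopologicalSpace

theorem DeltaOpen.isOpen {X : Type*} [TopologicalSpace X] {B : Set X}
    (hB : DeltaOpen B) : IsOpen B := by
  obtain ⟨𝒞, h𝒞, rfl⟩ := hB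
  refine isOpen_sUnion fun R hR => ?_
  rw [h𝒞 R hR]
  exact isOpen_interior

theorem SemiOpen.preimage {X Y : Type*} [TopologicalSpace X] [TopologicalSpace Y]
    {f : Y → X} (hf : Continuous f) (hfo : IsOpenMap f) {U : Set X} (hU : SemiOpen U) :
    SemiOpen (f ⁻¹' U) := by
  unfold SemiOpen
  rw [← hfo.preimage_interior_eq_interior_preimage hf,
    ← hfo.preimage_closure_eq_closure_preimage hf]
  exact preimage_mono hU

/-- If `A ⊆ B ⊆ X`, `B` is δ-open in `X` and `A` is sg-open in the
subspace `B`, then `A` is sg-open in `X`. -/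
theorem stmt_9 {X : Type*} [TopologicalSpace X] {A B : Set X}
    (hAB : A ⊆ B) (hB : DeltaOpen B)
    (h : SgOpen ((Subtype.val ⁻¹' A) : Set B)) :
    SgOpen A := by
  have hcont : Continuous (Subtype.val : B → X) := continuous_subtype_val
  have hopen : IsOpenMap (Subtype.val : B → X) := hB.isOpen.isOpenMap_subtype_val
  intro U hU hAU
  rw [sCl_eq_union_interior_closure]
  refine union_subset hAU fun x hx => ?_
  by_cases hxA : x ∈ A
  · have hsub := h (Subtype.val ⁻¹' U) (hU.preimage hcont hopen) (preimage_mono hAU)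
    rw [sCl_eq_union_interior_closure, ← preimage_compl,
      ← hopen.preimage_closure_eq_closure_preimage hcont,
      ← hopen.preimage_interior_eq_interior_preimage hcont] at hsub
    exact @hsub ⟨x, hAB hxA⟩ (Or.inr hx)
  · exact hAU hxA
end

section
/- An infinite indiscrete topological space is not sg-compact. Consequently, an open subspace of an sg-compact space need not be sg-compact (e.g., the open subspace A of the sg-compact space X = A ∪ {p} with topology {∅, A, X}, A infinite). -/
open Set TopologicalSpace

theorem IsOpen.semiOpen {X : Type*} [TopologicalSpace X] {A : Set X} (hA : IsOpen A) :
    SemiOpen A := by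
  rw [SemiOpen, hA.interior_eq]
  exact subset_closure

theorem sCl_empty {X : Type*} [TopologicalSpace X] : sCl (∅ : Set X) = ∅ :=
  subset_empty_iff.1 (sInter_subset_of_mem ⟨by simp [SemiClosed], Subset.rfl⟩)

/-- Every subset of an indiscrete space is sg-closed. -/
theorem sgClosed_of_indiscrete {Y : Type*} [TopologicalSpace Y]
    (h : ∀ s : Set Y, IsOpen s ↔ s = ∅ ∨ s = univ) (A : Set Y) : SgClosed A := by
  intro U hU hAU
  rcases (h _).1 (isOpen_interior (s := U)) with hi | hi
  · rw [SemiOpen, hi, closure_empty, subset_empty_iff] at hU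
    subst hU
    rw [subset_empty_iff.1 hAU, sCl_empty]
  · rw [interior_eq_univ.1 hi]
    exact subset_univ _

/-- An infinite indiscrete space is not sg-compact. -/
theorem not_sgCompact_of_indiscrete {Y : Type*} [TopologicalSpace Y] (hY : Infinite Y)
    (h : ∀ s : Set Y, IsOpen s ↔ s = ∅ ∨ s = univ) : ¬ SgCompact Y := by
  intro hc
  obtain ⟨ℱ, hℱ, hfin, hcov⟩ := hc (range fun y : Y => ({y} : Set Y))
    (fun _ _ => sgClosed_of_indiscrete h _) (by rw [sUnion_range, iUnion_of_singleton])
  refine infinite_univ (α := Y) (hcov ▸ hfin.sUnion fun s hs => ?_)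
  obtain ⟨y, rfl⟩ := hℱ hs
  exact finite_singleton y

/-- In a space `A ∪ {p}` with topology `{∅, A, univ}`, the only sg-open set containing `p` is the
whole space. -/
theorem SgOpen.eq_univ_of_mem {X : Type*} [TopologicalSpace X] {A U : Set X} {p : X}
    (hp : p ∉ A) (hAp : A ∪ {p} = univ) (h : ∀ s : Set X, IsOpen s ↔ s = ∅ ∨ s = A ∨ s = univ)
    (hU : SgOpen U) (hpU : p ∈ U) : U = univ := by
  have hAo : IsOpen A := (h A).2 (Or.inr (Or.inl rfl))
  have hUA : Uᶜ ⊆ A := by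
    intro y hy
    rcases (hAp ▸ mem_univ y : y ∈ A ∪ {p}) with hyA | rfl
    · exact hyA
    · exact absurd hpU hy
  by_contra hne
  obtain ⟨x, hx⟩ := (ne_univ_iff_exists_notMem U).1 hne
  have hAuniv : A = univ := by
    refine univ_subset_iff.1 (Subset.trans ?_ (hU A hAo.semiOpen hUA))
    rintro y - B ⟨hB, hUB⟩
    have hxB : x ∈ closure B := subset_closure (hUB hx)
    rcases (h _).1 (isClosed_closure (s := B)).isOpen_compl with h1 | h1 | h1
    · rw [SemiClosed, compl_empty_iff.1 h1, interior_univ] at hB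
      exact hB (mem_univ y)
    · exact absurd hxB (h1.symm ▸ hUA hx : x ∈ (closure B)ᶜ)
    · exact absurd hxB (h1.symm ▸ mem_univ x : x ∈ (closure B)ᶜ)
  exact hp (hAuniv ▸ mem_univ p)

/-- An infinite indiscrete space is not sg-compact; consequently
an open subspace of an sg-compact space need not be sg-compact: in
`X = A ∪ {p}` with topology `{∅, A, X}` and `A` infinite, `A` is an open subset,
`X` is sg-compact, but the subspace `A` is not sg-compact. -/
theorem stmt_16 :
    (∀ (Y : Type*) [TopologicalSpace Y], Infinite Y →
      (∀ s : Set Y, IsOpen s ↔ s = ∅ ∨ s = univ) → ¬ SgCompact Y) ∧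
    (∀ (X : Type*) [TopologicalSpace X] (A : Set X) (p : X),
      p ∉ A → A.Infinite → A ∪ {p} = univ →
      (∀ s : Set X, IsOpen s ↔ s = ∅ ∨ s = A ∨ s = univ) →
      IsOpen A ∧ SgCompact X ∧ ¬ SgCompact A) := by
  refine ⟨fun Y _ hY h => not_sgCompact_of_indiscrete hY h, ?_⟩
  intro X _ A p hp hA hAp h
  have hAo : IsOpen A := (h A).2 (Or.inr (Or.inl rfl))
  refine ⟨hAo, ?_, ?_⟩
  · intro 𝒰 h𝒰 hcov
    obtain ⟨U, hU, hpU⟩ : p ∈ ⋃₀ 𝒰 := hcov ▸ mem_univ p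
    refine ⟨{U}, singleton_subset_iff.2 hU, finite_singleton U, ?_⟩
    rw [sUnion_singleton]
    exact (h𝒰 U hU).eq_univ_of_mem hp hAp h hpU
  · refine not_sgCompact_of_indiscrete hA.to_subtype fun s => ⟨?_, ?_⟩
    · intro hs
      have hs' := hAo.isOpenMap_subtype_val s hs
      rcases (h _).1 hs' with h1 | h1 | h1
      · exact Or.inl (image_eq_empty.1 h1)
      · refine Or.inr (eq_univ_of_forall fun x => ?_)
        obtain ⟨y, hy, hyx⟩ := h1.superset x.2
        exact Subtype.ext hyx ▸ hy
      · obtain ⟨y, -, hyp⟩ := h1.superset (mem_univ p)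
        exact absurd (hyp ▸ y.2) hp
    · rintro (rfl | rfl)
      · exact isOpen_empty
      · exact isOpen_univ
end
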